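/- arXiv:2004.12493 — 7 statements merged into one kernel-verified Lean document; each statement's English description precedes it below -/
import Mathlib

section
/- Let V be a random variable on Ω (with values in some measurable space) satisfying distributional consistency. Then the conditional distribution of V given the pair (T, T*) can be chosen the same in all three regimes; precisely: for all t, t* ∈ {0,1}, all regimes r, s ∈ {0, 1, e}, and every measurable set A, if μ_r(T = t, T* = t*) > 0 and μ_s(T = t, T* = t*) > 0, then μ_r(V ∈ A | T = t, T* = t*) = μ_s(V ∈ A | T = t, T* = t*). (This is the extended conditional independence V ⊥ F_T | (T, T*) of Lemma 1.) -/
open MeasureTheory ProbabilityTheory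

/-- Conditioning on almost everywhere equal sets gives the same measure. -/
theorem cond_congr_set_ae {Ω : Type*} [MeasurableSpace Ω] {μ : Measure Ω} {s t : Set Ω}
    (h : ∀ᵐ ω ∂μ, ω ∈ s ↔ ω ∈ t) : μ[|s] = μ[|t] := by
  have h' : s =ᵐ[μ] t := Filter.eventuallyEq_set.mpr h
  simp only [ProbabilityTheory.cond, measure_congr h', Measure.restrict_congr_set h']

/-- A property of positive measure and an almost sure property hold together at some point. -/
theorem exists_of_measure_pos_of_ae {Ω : Type*} [MeasurableSpace Ω] {μ : Measure Ω}
    {p q : Ω → Prop} (hp : ∀ᵐ ω ∂μ, p ω) (hq : 0 < μ {ω | q ω}) : ∃ ω, p ω ∧ q ω := by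
  have hfreq : ∃ᵐ ω ∂μ, q ω := frequently_ae_iff.mpr hq.ne'
  obtain ⟨ω, hω⟩ := (hfreq.and_eventually hp).exists
  exact ⟨ω, hω.2, hω.1⟩

/-- In a three-regime treatment model, if `V` satisfies distributional
consistency, then the conditional distribution of `V` given `(T, T*)` can be chosen the same
in all three regimes (the extended conditional independence `V ⫫ F_T | (T, T*)`). -/
theorem dt_eci_given_T_Tstar
    {Ω : Type*} [MeasurableSpace Ω] {β : Type*} [MeasurableSpace β]
    (μ0 μ1 μe : Measure Ω)
    [IsProbabilityMeasure μ0] [IsProbabilityMeasure μ1] [IsProbabilityMeasure μe]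
    (T Tstar : Ω → Bool) (hT : Measurable T) (hTstar : Measurable Tstar)
    (hT0 : ∀ᵐ ω ∂μ0, T ω = false)
    (hT1 : ∀ᵐ ω ∂μ1, T ω = true)
    (hTe : ∀ᵐ ω ∂μe, T ω = Tstar ω)
    (hTstarDist : ∀ t : Bool,
      μ0 {ω | Tstar ω = t} = μe {ω | Tstar ω = t} ∧
      μ1 {ω | Tstar ω = t} = μe {ω | Tstar ω = t})
    (V : Ω → β) (hV : Measurable V)
    (hDC : ∀ t : Bool, 0 < μe {ω | Tstar ω = t} →
      ∀ A : Set β, MeasurableSet A →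
        μe[|{ω | Tstar ω = t}] {ω | V ω ∈ A} =
          (bif t then μ1 else μ0)[|{ω | Tstar ω = t}] {ω | V ω ∈ A}) :
    ∀ t tstar : Bool, ∀ μr ∈ ({μ0, μ1, μe} : Set (Measure Ω)),
      ∀ μs ∈ ({μ0, μ1, μe} : Set (Measure Ω)),
      ∀ A : Set β, MeasurableSet A →
        0 < μr {ω | T ω = t ∧ Tstar ω = tstar} →
        0 < μs {ω | T ω = t ∧ Tstar ω = tstar} →
        μr[|{ω | T ω = t ∧ Tstar ω = tstar}] {ω | V ω ∈ A} =
          μs[|{ω | T ω = t ∧ Tstar ω = tstar}] {ω | V ω ∈ A} := by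
  intro t tstar
  have key : ∀ μ ∈ ({μ0, μ1, μe} : Set (Measure Ω)), ∀ A : Set β, MeasurableSet A →
      0 < μ {ω | T ω = t ∧ Tstar ω = tstar} →
      μ[|{ω | T ω = t ∧ Tstar ω = tstar}] {ω | V ω ∈ A} =
        (bif t then μ1 else μ0)[|{ω | Tstar ω = tstar}] {ω | V ω ∈ A} := by
    rintro μ (rfl | rfl | rfl) A hA hpos
    · obtain ⟨ω, h, rfl, -⟩ := exists_of_measure_pos_of_ae hT0 hpos
      rw [h, cond_false, cond_congr_set_ae (t := {ω | Tstar ω = tstar})]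
      filter_upwards [hT0] with ω' h'
      simp [h']
    · obtain ⟨ω, h, rfl, -⟩ := exists_of_measure_pos_of_ae hT1 hpos
      rw [h, cond_true, cond_congr_set_ae (t := {ω | Tstar ω = tstar})]
      filter_upwards [hT1] with ω' h'
      simp [h']
    · obtain ⟨ω, h, h₁, h₂⟩ := exists_of_measure_pos_of_ae hTe hpos
      obtain rfl : t = tstar := h₁.symm.trans (h.trans h₂)
      rw [← hDC t (hpos.trans_le (measure_mono fun _ hx => hx.2)) A hA,
        cond_congr_set_ae (t := {ω | Tstar ω = t})]
      filter_upwards [hTe] with ω' h'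
      simp [h']
  intro μr hr μs hs A hA hposr hposs
  rw [key μr hr A hA hposr, key μs hs A hA hposs]
end

section
/- Let Y be a real-valued random variable on Ω, integrable under each of μ_0, μ_1, μ_e, satisfying distributional consistency and ignorability, and suppose μ_e(T = 0) > 0 and μ_e(T = 1) > 0. Then the average causal effect is identified from the observational regime: ∫ Y dμ_1 − ∫ Y dμ_0 = ∫ Y dμ_e(· | T = 1) − ∫ Y dμ_e(· | T = 0). -/
open MeasureTheory ProbabilityTheory

/-- Conditioning on almost everywhere equal sets gives the same measure. -/
lemma cond_congr_ae_set {Ω : Type*} [MeasurableSpace Ω] {μ : Measure Ω} {s t : Set Ω}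
    (h : s =ᵐ[μ] t) : μ[|s] = μ[|t] := by
  simp only [ProbabilityTheory.cond, measure_congr h, Measure.restrict_congr_set h]

/-- The integral of a real random variable is determined by its distribution. -/
lemma integral_eq_of_forall_measure_preimage_eq {Ω : Type*} [MeasurableSpace Ω] {μ ν : Measure Ω}
    {Y : Ω → ℝ} (hY : Measurable Y)
    (h : ∀ A : Set ℝ, MeasurableSet A → μ {ω | Y ω ∈ A} = ν {ω | Y ω ∈ A}) :
    ∫ ω, Y ω ∂μ = ∫ ω, Y ω ∂ν := by
  have hmap : μ.map Y = ν.map Y := by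
    ext A hA
    rw [Measure.map_apply hY hA, Measure.map_apply hY hA]
    exact h A hA
  have hid (ρ : Measure Ω) : ∫ ω, Y ω ∂ρ = ∫ y, y ∂(ρ.map Y) :=
    (integral_map hY.aemeasurable aestronglyMeasurable_id).symm
  rw [hid μ, hid ν, hmap]

/-- In a three-regime treatment model, for an integrable real response `Y`
satisfying distributional consistency and ignorability, with both treatment arms having
positive observational probability, the average causal effect is identified from the
observational regime:
`∫ Y dμ1 − ∫ Y dμ0 = ∫ Y dμe(·|T=1) − ∫ Y dμe(·|T=0)`. -/
theorem dt_ACE_identification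
    {Ω : Type*} [MeasurableSpace Ω]
    (μ0 μ1 μe : Measure Ω)
    [IsProbabilityMeasure μ0] [IsProbabilityMeasure μ1] [IsProbabilityMeasure μe]
    (T Tstar : Ω → Bool) (hT : Measurable T) (hTstar : Measurable Tstar)
    (hT0 : ∀ᵐ ω ∂μ0, T ω = false)
    (hT1 : ∀ᵐ ω ∂μ1, T ω = true)
    (hTe : ∀ᵐ ω ∂μe, T ω = Tstar ω)
    (hTstarDist : ∀ t : Bool,
      μ0 {ω | Tstar ω = t} = μe {ω | Tstar ω = t} ∧
      μ1 {ω | Tstar ω = t} = μe {ω | Tstar ω = t})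
    (Y : Ω → ℝ) (hY : Measurable Y)
    (hInt0 : Integrable Y μ0) (hInt1 : Integrable Y μ1) (hInte : Integrable Y μe)
    (hDC : ∀ t : Bool, 0 < μe {ω | Tstar ω = t} →
      ∀ A : Set ℝ, MeasurableSet A →
        μe[|{ω | Tstar ω = t}] {ω | Y ω ∈ A} =
          (bif t then μ1 else μ0)[|{ω | Tstar ω = t}] {ω | Y ω ∈ A})
    (hIgn : ∀ t tstar : Bool, 0 < (bif t then μ1 else μ0) {ω | Tstar ω = tstar} →
      ∀ A : Set ℝ, MeasurableSet A →
        (bif t then μ1 else μ0)[|{ω | Tstar ω = tstar}] {ω | Y ω ∈ A} =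
          (bif t then μ1 else μ0) {ω | Y ω ∈ A})
    (hpos0 : 0 < μe {ω | T ω = false}) (hpos1 : 0 < μe {ω | T ω = true}) :
    ∫ ω, Y ω ∂μ1 - ∫ ω, Y ω ∂μ0 =
      ∫ ω, Y ω ∂(μe[|{ω | T ω = true}]) - ∫ ω, Y ω ∂(μe[|{ω | T ω = false}]) := by
  have hset (t : Bool) : {ω | T ω = t} =ᵐ[μe] {ω | Tstar ω = t} := by
    filter_upwards [hTe] with ω hω
    exact congrArg (· = t) hω
  have hdist (t : Bool) :
      (bif t then μ1 else μ0) {ω | Tstar ω = t} = μe {ω | Tstar ω = t} := by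
    cases t
    · exact (hTstarDist false).1
    · exact (hTstarDist true).2
  have key (t : Bool) (hpos : 0 < μe {ω | T ω = t}) :
      ∫ ω, Y ω ∂(bif t then μ1 else μ0) = ∫ ω, Y ω ∂(μe[|{ω | T ω = t}]) := by
    rw [measure_congr (hset t)] at hpos
    rw [cond_congr_ae_set (hset t)]
    refine integral_eq_of_forall_measure_preimage_eq hY fun A hA ↦ ?_
    rw [hDC t hpos A hA, hIgn t t ((hdist t).symm ▸ hpos) A hA]
  exact congrArg₂ (· - ·) (key true hpos1) (key false hpos0)
end

section
/- Let X be a random variable on Ω (with values in some measurable space) such that: (i) X satisfies distributional consistency; and (ii) the pair (X, T*) has the same joint distribution under μ_0 and μ_1. Then (X, T*) ⊥ F_T: the joint distribution of (X, T*) is the same under all three measures μ_0, μ_1, μ_e. (Lemma 3, first assertion.) -/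
open MeasureTheory ProbabilityTheory

/-- The joint laws of `(X, Y)` with `Y` countably valued agree as soon as they agree on all
rectangles `A ×ˢ {y}`. -/
theorem map_prodMk_eq_of_forall_inter_preimage_singleton
    {Ω β γ : Type*} [MeasurableSpace Ω] [MeasurableSpace β] [MeasurableSpace γ]
    [Countable γ] [MeasurableSingletonClass γ] {μ ν : Measure Ω} {X : Ω → β} {Y : Ω → γ}
    (hX : Measurable X) (hY : Measurable Y)
    (h : ∀ y : γ, ∀ A : Set β, MeasurableSet A →
      μ ({ω | Y ω = y} ∩ {ω | X ω ∈ A}) = ν ({ω | Y ω = y} ∩ {ω | X ω ∈ A})) :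
    μ.map (fun ω => (X ω, Y ω)) = ν.map (fun ω => (X ω, Y ω)) := by
  ext s hs
  have hslice (y : γ) : MeasurableSet {b : β | (b, y) ∈ s} := measurable_prodMk_right hs
  have hunion : (fun ω => (X ω, Y ω)) ⁻¹' s =
      ⋃ y : γ, {ω | Y ω = y} ∩ {ω | X ω ∈ {b : β | (b, y) ∈ s}} := by
    ext ω
    simp
  have hdisj : Pairwise (Function.onFun Disjoint
      fun y : γ => {ω | Y ω = y} ∩ {ω | X ω ∈ {b : β | (b, y) ∈ s}}) := by
    intro y z hyz
    refine Set.disjoint_left.2 fun ω hy hz => hyz ?_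
    exact hy.1.symm.trans hz.1
  have hmeas (y : γ) : MeasurableSet ({ω | Y ω = y} ∩ {ω | X ω ∈ {b : β | (b, y) ∈ s}}) :=
    (hY (measurableSet_singleton y)).inter (hX (hslice y))
  rw [Measure.map_apply (hX.prodMk hY) hs, Measure.map_apply (hX.prodMk hY) hs, hunion,
    measure_iUnion hdisj hmeas, measure_iUnion hdisj hmeas]
  exact tsum_congr fun y => h y _ (hslice y)

/-- If two finite measures give the same mass to `E` and, when that mass is positive, the same
conditional probability of `F` given `E`, then they give the same mass to `E ∩ F`. -/
theorem measure_inter_eq_of_cond_eq {Ω : Type*} [MeasurableSpace Ω] {μ ν : Measure Ω}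
    [IsFiniteMeasure μ] [IsFiniteMeasure ν] {E F : Set Ω} (hE : MeasurableSet E)
    (hmass : μ E = ν E) (hcond : 0 < ν E → ν[|E] F = μ[|E] F) :
    μ (E ∩ F) = ν (E ∩ F) := by
  rcases eq_or_ne (ν E) 0 with h0 | h0
  · rw [measure_inter_null_of_null_left F h0, measure_inter_null_of_null_left F (hmass.trans h0)]
  · rw [← cond_mul_eq_inter hE F μ, ← cond_mul_eq_inter hE F ν, hmass,
      hcond (pos_iff_ne_zero.2 h0)]

/-- **Lemma 3, first assertion.** In a three-regime treatment model, if `X`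
satisfies distributional consistency and the pair `(X, T*)` has the same joint distribution
under the two interventional regimes `μ0` and `μ1`, then `(X, T*) ⫫ F_T`: the joint
distribution of `(X, T*)` is the same under all three measures `μ0, μ1, μe`. -/
theorem dt_sufficient_covariate_joint_indep_regime
    {Ω : Type*} [MeasurableSpace Ω] {β : Type*} [MeasurableSpace β]
    (μ0 μ1 μe : Measure Ω)
    [IsProbabilityMeasure μ0] [IsProbabilityMeasure μ1] [IsProbabilityMeasure μe]
    (T Tstar : Ω → Bool) (hT : Measurable T) (hTstar : Measurable Tstar)
    (hT0 : ∀ᵐ ω ∂μ0, T ω = false)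
    (hT1 : ∀ᵐ ω ∂μ1, T ω = true)
    (hTe : ∀ᵐ ω ∂μe, T ω = Tstar ω)
    (hTstarDist : ∀ t : Bool,
      μ0 {ω | Tstar ω = t} = μe {ω | Tstar ω = t} ∧
      μ1 {ω | Tstar ω = t} = μe {ω | Tstar ω = t})
    (X : Ω → β) (hX : Measurable X)
    (hDC : ∀ t : Bool, 0 < μe {ω | Tstar ω = t} →
      ∀ A : Set β, MeasurableSet A →
        μe[|{ω | Tstar ω = t}] {ω | X ω ∈ A} =
          (bif t then μ1 else μ0)[|{ω | Tstar ω = t}] {ω | X ω ∈ A})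
    (hJoint01 : μ0.map (fun ω => (X ω, Tstar ω)) = μ1.map (fun ω => (X ω, Tstar ω))) :
    μ0.map (fun ω => (X ω, Tstar ω)) = μe.map (fun ω => (X ω, Tstar ω)) ∧
    μ1.map (fun ω => (X ω, Tstar ω)) = μe.map (fun ω => (X ω, Tstar ω)) := by
  have hrect (t : Bool) (A : Set β) (hA : MeasurableSet A) :
      (bif t then μ1 else μ0) ({ω | Tstar ω = t} ∩ {ω | X ω ∈ A}) =
        μe ({ω | Tstar ω = t} ∩ {ω | X ω ∈ A}) := by
    have hE : MeasurableSet {ω | Tstar ω = t} := hTstar (measurableSet_singleton t)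
    have hc := fun h => hDC t h A hA
    cases t
    · exact measure_inter_eq_of_cond_eq (μ := μ0) hE (hTstarDist false).1 hc
    · exact measure_inter_eq_of_cond_eq (μ := μ1) hE (hTstarDist true).2 hc
  have h01 (t : Bool) (A : Set β) (hA : MeasurableSet A) :
      μ0 ({ω | Tstar ω = t} ∩ {ω | X ω ∈ A}) = μ1 ({ω | Tstar ω = t} ∩ {ω | X ω ∈ A}) := by
    have hs : MeasurableSet {p : β × Bool | p.2 = t ∧ p.1 ∈ A} :=
      (measurable_snd (measurableSet_singleton t)).inter (measurable_fst hA)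
    have h := congrArg (fun ρ => ρ {p : β × Bool | p.2 = t ∧ p.1 ∈ A}) hJoint01
    simp only [Measure.map_apply (hX.prodMk hTstar) hs] at h
    exact h
  have h0e : μ0.map (fun ω => (X ω, Tstar ω)) = μe.map (fun ω => (X ω, Tstar ω)) := by
    refine map_prodMk_eq_of_forall_inter_preimage_singleton hX hTstar fun t A hA => ?_
    cases t
    · exact hrect false A hA
    · exact (h01 true A hA).trans (hrect true A hA)
  exact ⟨h0e, hJoint01.symm.trans h0e⟩
end

section
/- (g-computation / decision-theoretic do-calculus.) Suppose: (i) there is a function q : 𝒴 × 𝒵 × 𝒳1 → [0,1] such that for every regime r ∈ R and all values x0', z, x1', y with μ_r(X0 = x0', Z = z, X1 = x1') > 0, μ_r(Y = y | X0 = x0', Z = z, X1 = x1') = q(y, z, x1') (the extended conditional independence Y ⊥ (F0, X0, F1) | (Z, X1)); (ii) there is a function s : 𝒵 × 𝒳0 → [0,1] such that for every regime r ∈ R and every x0' with μ_r(X0 = x0') > 0, μ_r(Z = z | X0 = x0') = s(z, x0') for all z (the extended conditional independence Z ⊥ (F0, F1) | X0). Fix x0 ∈ 𝒳0 and x1 ∈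 𝒳1; write μ = μ_{(x0, x1)} (both interventions applied) and ν = μ_{(e, e)} (observational). Assume ν(X0 = x0) > 0 and that for every z with ν(Z = z | X0 = x0) > 0 one has ν(Z = z, X1 = x1) > 0. Then for every y ∈ 𝒴: μ(Y = y) = Σ_z ν(Y = y | Z = z, X1 = x1) · ν(Z = z | X0 = x0), the sum ranging over all z with ν(Z = z | X0 = x0) > 0. -/
open MeasureTheory ProbabilityTheory
open scoped ENNReal

/-- Law of total probability over the fibres of a random variable with countable range. -/
theorem measure_eq_tsum_fiber_inter {Ω α : Type*} [MeasurableSpace Ω] [Countable α]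
    [MeasurableSpace α] [MeasurableSingletonClass α] (m : Measure Ω) {W : Ω → α}
    (hW : Measurable W) (E : Set Ω) :
    m E = ∑' w, m (W ⁻¹' {w} ∩ E) := by
  have hfib (w : α) : MeasurableSet (W ⁻¹' {w}) := hW (measurableSet_singleton w)
  have h := measure_iUnion (μ := m.restrict E) (f := fun w => W ⁻¹' {w})
    (fun _ _ hab => Disjoint.preimage W (Set.disjoint_singleton.mpr hab)) hfib
  rw [← Set.preimage_iUnion, Set.iUnion_of_singleton, Set.preimage_univ,
    Measure.restrict_apply_univ] at h
  simpa only [Measure.restrict_apply (hfib _)] using h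

/-- If the conditional probability of `A` given `B` and `W = w` does not depend on `w`, then it is
also the conditional probability of `A` given `B`. -/
theorem cond_eq_of_forall_cond_fiber_eq {Ω α : Type*} [MeasurableSpace Ω] [Countable α]
    [MeasurableSpace α] [MeasurableSingletonClass α] (m : Measure Ω) [IsFiniteMeasure m]
    {W : Ω → α} (hW : Measurable W) {A B : Set Ω} (hB : MeasurableSet B) (hB0 : m B ≠ 0)
    {c : ℝ≥0∞} (h : ∀ w, 0 < m (W ⁻¹' {w} ∩ B) → m[|W ⁻¹' {w} ∩ B] A = c) :
    m[|B] A = c := by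
  have hinter : m (B ∩ A) = c * m B := by
    rw [measure_eq_tsum_fiber_inter m hW (B ∩ A), measure_eq_tsum_fiber_inter m hW B,
      ← ENNReal.tsum_mul_left]
    refine tsum_congr fun w => ?_
    rw [← Set.inter_assoc]
    rcases eq_or_ne (m (W ⁻¹' {w} ∩ B)) 0 with h0 | h0
    · rw [h0, mul_zero, measure_mono_null Set.inter_subset_left h0]
    · rw [← h w (pos_iff_ne_zero.mpr h0),
        cond_mul_eq_inter ((hW (measurableSet_singleton w)).inter hB)]
  rw [cond_apply hB, hinter, mul_comm, mul_assoc, ENNReal.mul_inv_cancel hB0 (measure_ne_top m B),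
    mul_one]

/-- **g-computation / DT do-calculus.** In a two-point-intervention model with
regimes indexed by `Option 𝒳0 × Option 𝒳1` (`none` = idle), under the extended conditional
independencies `Y ⫫ (F0, X0, F1) | (Z, X1)` and `Z ⫫ (F0, F1) | X0`, and suitable positivity,
the interventional distribution of `Y` is given by the g-computation formula from the
observational regime. -/
theorem dt_g_computation
    {Ω : Type*} [MeasurableSpace Ω]
    {𝒳0 𝒳1 𝒵 𝒴 : Type*} [Countable 𝒳0] [Countable 𝒳1] [Countable 𝒵] [Countable 𝒴]
    [MeasurableSpace 𝒳0] [MeasurableSingletonClass 𝒳0]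
    [MeasurableSpace 𝒳1] [MeasurableSingletonClass 𝒳1]
    [MeasurableSpace 𝒵] [MeasurableSingletonClass 𝒵]
    [MeasurableSpace 𝒴] [MeasurableSingletonClass 𝒴]
    (μ : Option 𝒳0 × Option 𝒳1 → Measure Ω)
    [∀ r, IsProbabilityMeasure (μ r)]
    (X0 : Ω → 𝒳0) (Z : Ω → 𝒵) (X1 : Ω → 𝒳1) (Y : Ω → 𝒴)
    (hX0 : Measurable X0) (hZ : Measurable Z) (hX1 : Measurable X1) (hY : Measurable Y)
    (hF0 : ∀ r : Option 𝒳0 × Option 𝒳1, ∀ x0 : 𝒳0, r.1 = some x0 →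
      ∀ᵐ ω ∂(μ r), X0 ω = x0)
    (hF1 : ∀ r : Option 𝒳0 × Option 𝒳1, ∀ x1 : 𝒳1, r.2 = some x1 →
      ∀ᵐ ω ∂(μ r), X1 ω = x1)
    -- (i) Y ⫫ (F0, X0, F1) | (Z, X1)
    (q : 𝒴 → 𝒵 → 𝒳1 → ℝ≥0∞)
    (hq : ∀ r : Option 𝒳0 × Option 𝒳1, ∀ (x0' : 𝒳0) (z : 𝒵) (x1' : 𝒳1),
      0 < μ r {ω | X0 ω = x0' ∧ Z ω = z ∧ X1 ω = x1'} →
      ∀ y : 𝒴,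
        (μ r)[|{ω | X0 ω = x0' ∧ Z ω = z ∧ X1 ω = x1'}] {ω | Y ω = y} = q y z x1')
    -- (ii) Z ⫫ (F0, F1) | X0
    (s : 𝒵 → 𝒳0 → ℝ≥0∞)
    (hs : ∀ r : Option 𝒳0 × Option 𝒳1, ∀ x0' : 𝒳0,
      0 < μ r {ω | X0 ω = x0'} →
      ∀ z : 𝒵, (μ r)[|{ω | X0 ω = x0'}] {ω | Z ω = z} = s z x0')
    (x0 : 𝒳0) (x1 : 𝒳1)
    (hpos : 0 < μ (none, none) {ω | X0 ω = x0})
    (hsupp : ∀ z : 𝒵,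
      0 < (μ (none, none))[|{ω | X0 ω = x0}] {ω | Z ω = z} →
      0 < μ (none, none) {ω | Z ω = z ∧ X1 ω = x1}) :
    ∀ y : 𝒴,
      μ (some x0, some x1) {ω | Y ω = y} =
        ∑' z : {z : 𝒵 // 0 < (μ (none, none))[|{ω | X0 ω = x0}] {ω | Z ω = z}},
          (μ (none, none))[|{ω | Z ω = (z : 𝒵) ∧ X1 ω = x1}] {ω | Y ω = y} *
            (μ (none, none))[|{ω | X0 ω = x0}] {ω | Z ω = (z : 𝒵)} := by
  intro y
  have hfib (z : 𝒵) : MeasurableSet {ω | Z ω = z} := hZ (measurableSet_singleton z)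
  have hmX0 : MeasurableSet {ω | X0 ω = x0} := hX0 (measurableSet_singleton x0)
  have hmX1 : MeasurableSet {ω | X1 ω = x1} := hX1 (measurableSet_singleton x1)
  have hae0 := hF0 (some x0, some x1) x0 rfl
  have hae1 := hF1 (some x0, some x1) x1 rfl
  have hX0_one : μ (some x0, some x1) {ω | X0 ω = x0} = 1 := prob_compl_eq_zero_iff hmX0 |>.mp hae0
  have hZ_eq (z : 𝒵) : μ (some x0, some x1) {ω | Z ω = z} =
      (μ (none, none))[|{ω | X0 ω = x0}] {ω | Z ω = z} := by
    rw [hs _ x0 hpos z, ← hs (some x0, some x1) x0 (by simp [hX0_one]) z, cond_apply hmX0, hX0_one,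
      inv_one, one_mul]
    refine measure_congr ?_
    filter_upwards [hae0] with ω h
    exact propext (and_iff_right h).symm
  rw [measure_eq_tsum_fiber_inter _ hZ {ω | Y ω = y}]
  refine Eq.trans ?_ (Eq.symm (tsum_subtype
    {z | 0 < (μ (none, none))[|{ω | X0 ω = x0}] {ω | Z ω = z}}
    fun z => (μ (none, none))[|{ω | Z ω = z ∧ X1 ω = x1}] {ω | Y ω = y} *
      (μ (none, none))[|{ω | X0 ω = x0}] {ω | Z ω = z}))
  refine tsum_congr fun z => ?_
  by_cases hz : 0 < (μ (none, none))[|{ω | X0 ω = x0}] {ω | Z ω = z}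
  · rw [Set.indicator_of_mem (by exact hz)]
    have hobs : (μ (none, none))[|{ω | Z ω = z ∧ X1 ω = x1}] {ω | Y ω = y} = q y z x1 :=
      cond_eq_of_forall_cond_fiber_eq _ hX0 ((hfib z).inter hmX1) (hsupp z hz).ne'
        fun x0' h => hq _ x0' z x1 h y
    have hjoint : {ω | X0 ω = x0 ∧ Z ω = z ∧ X1 ω = x1} =ᵐ[μ (some x0, some x1)]
        {ω | Z ω = z} := by
      filter_upwards [hae0, hae1] with ω h0 h1
      exact propext ((and_iff_right h0).trans (and_iff_left h1))
    have hcond := hq (some x0, some x1) x0 z x1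
      (by rwa [measure_congr hjoint, hZ_eq z]) y
    rw [hobs, ← hcond, ← hZ_eq z, ← measure_congr hjoint]
    exact (measure_congr (hjoint.symm.inter (ae_eq_refl _))).trans
      (cond_mul_eq_inter (hmX0.inter ((hfib z).inter hmX1)) _ _).symm
  · rw [Set.indicator_of_notMem (by exact hz)]
    refine measure_mono_null Set.inter_subset_left ?_
    exact (hZ_eq z).trans (not_lt.mp hz |>.antisymm bot_le)
end

section
/- (Generalised form of Appendix Lemma A.2.) Let U, S, G1, G2, W be random variables on (Ω, 𝒜, P). Assume: (i) G2 ⊥ G1 | W; (ii) U ⊥ G1 | (G2, W); (iii) U ⊥ G2 | (G1, W); (iv) U ⊥ S | (G1, G2, W). Then U ⊥ (G1, G2, S) | W. -/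
open MeasureTheory ProbabilityTheory

namespace ProbabilityTheory

variable {Ω : Type*} {m n m' m₁ m₂ m₃ mΩ : MeasurableSpace Ω} {μ : Measure Ω} {f : Ω → ℝ}
  {s t : Set Ω}

lemma condExp_indicator_condExp_of_le [IsFiniteMeasure μ] (hmn : m ≤ n) (hn : n ≤ mΩ)
    (hf : Integrable f μ) (ht : MeasurableSet[n] t) :
    μ[t.indicator (μ[f | n]) | m] =ᵐ[μ] μ[t.indicator f | m] :=
  (condExp_congr_ae (condExp_indicator hf ht).symm).trans (condExp_condExp_of_le hmn hn)

lemma condExp_indicator_condExp_self [IsFiniteMeasure μ] (ht : MeasurableSet t) :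
    μ[t.indicator (μ[f | m]) | m] =ᵐ[μ] (μ⟦t | m⟧) * μ[f | m] := by
  have h : t.indicator (μ[f | m]) = t.indicator (fun _ ↦ (1 : ℝ)) * μ[f | m] := by
    ext ω
    by_cases hω : ω ∈ t <;> simp [hω]
  rw [h]
  refine condExp_mul_of_stronglyMeasurable_right stronglyMeasurable_condExp ?_
    ((integrable_const _).indicator ht)
  rw [← h]
  exact integrable_condExp.indicator ht

lemma indicator_inter_one (s t : Set Ω) :
    (s ∩ t).indicator (fun _ ↦ (1 : ℝ)) = t.indicator (s.indicator fun _ ↦ 1) := by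
  rw [Set.indicator_indicator, Set.inter_comm]

lemma sup_eq_generateFrom_image2_inter :
    m₁ ⊔ m₂ = MeasurableSpace.generateFrom
      (Set.image2 (· ∩ ·) {s | MeasurableSet[m₁] s} {s | MeasurableSet[m₂] s}) := by
  apply le_antisymm
  · refine sup_le (fun s hs ↦ ?_) (fun s hs ↦ ?_)
    · exact MeasurableSpace.measurableSet_generateFrom
        ⟨s, hs, Set.univ, MeasurableSet.univ, Set.inter_univ s⟩
    · exact MeasurableSpace.measurableSet_generateFrom
        ⟨Set.univ, MeasurableSet.univ, s, hs, Set.univ_inter s⟩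
  · refine MeasurableSpace.generateFrom_le ?_
    rintro _ ⟨s, hs, t, ht, rfl⟩
    exact MeasurableSet.inter (le_sup_left (a := m₁) s hs) (le_sup_right (a := m₁) t ht)

lemma isPiSystem_image2_inter_measurableSet :
    IsPiSystem (Set.image2 (· ∩ ·) {s | MeasurableSet[m₁] s} {s | MeasurableSet[m₂] s}) := by
  rintro _ ⟨s, hs, t, ht, rfl⟩ _ ⟨s', hs', t', ht', rfl⟩ -
  exact ⟨s ∩ s', MeasurableSet.inter hs hs', t ∩ t', MeasurableSet.inter ht ht',
    Set.inter_inter_inter_comm s s' t t'⟩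

/-- Two integrable functions whose integrals agree on the sets of a π-system and on the whole
space have the same integrals on the sets of the generated σ-algebra. -/
lemma setIntegral_eq_of_generateFrom_piSystem {f g : Ω → ℝ} {S : Set (Set Ω)} (hm : m ≤ mΩ)
    (hS : m = MeasurableSpace.generateFrom S) (hpi : IsPiSystem S)
    (hf : Integrable f μ) (hg : Integrable g μ) (huniv : ∫ ω, f ω ∂μ = ∫ ω, g ω ∂μ)
    (h : ∀ s ∈ S, ∫ ω in s, f ω ∂μ = ∫ ω in s, g ω ∂μ) (hs : MeasurableSet[m] s) :
    ∫ ω in s, f ω ∂μ = ∫ ω in s, g ω ∂μ := by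
  induction s, hs using MeasurableSpace.induction_on_inter hS hpi with
  | empty => simp
  | basic s hs => exact h s hs
  | compl s hs ih =>
    rw [setIntegral_compl (hm s hs) hf, setIntegral_compl (hm s hs) hg, huniv, ih]
  | iUnion s hd hs ih =>
    rw [integral_iUnion (fun i ↦ hm _ (hs i)) hd hf.integrableOn,
      integral_iUnion (fun i ↦ hm _ (hs i)) hd hg.integrableOn]
    exact tsum_congr ih

variable [StandardBorelSpace Ω] [IsFiniteMeasure μ]

/-- `m₁` and `m₂` are conditionally independent given `m'` iff conditioning an event of `m₁` on
`m₂` in addition to `m'` does not change its conditional probability. -/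
lemma condIndep_iff_condExp_sup_ae_eq (hm' : m' ≤ mΩ) (hm₁ : m₁ ≤ mΩ) (hm₂ : m₂ ≤ mΩ) :
    CondIndep m' m₁ m₂ hm' μ ↔
      ∀ s, MeasurableSet[m₁] s → μ⟦s | m₂ ⊔ m'⟧ =ᵐ[μ] μ⟦s | m'⟧ := by
  rw [condIndep_iff _ _ _ hm' hm₁ hm₂]
  refine ⟨fun h s hs ↦ ?_, fun h s t hs ht ↦ ?_⟩
  · have hs_int : Integrable (s.indicator fun _ ↦ (1 : ℝ)) μ :=
      (integrable_const _).indicator (hm₁ s hs)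
    refine (ae_eq_condExp_of_forall_setIntegral_eq (sup_le hm₂ hm') hs_int
      (fun _ _ _ ↦ integrable_condExp.integrableOn) (fun u hu _ ↦ ?_)
      (stronglyMeasurable_condExp.mono
        (le_sup_right : m' ≤ m₂ ⊔ m')).aestronglyMeasurable).symm
    refine setIntegral_eq_of_generateFrom_piSystem (sup_le hm₂ hm')
      sup_eq_generateFrom_image2_inter isPiSystem_image2_inter_measurableSet
      integrable_condExp hs_int (integral_condExp hm') ?_ hu
    rintro _ ⟨b, hb, c, hc, rfl⟩
    have hb' : MeasurableSet b := hm₂ b hb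
    have key : μ[b.indicator (μ⟦s | m'⟧) | m'] =ᵐ[μ]
        μ[b.indicator (s.indicator fun _ ↦ (1 : ℝ)) | m'] := by
      rw [← indicator_inter_one]
      refine (condExp_indicator_condExp_self hb').trans ((h s b hs hb).trans ?_).symm
      rw [mul_comm]
    simp only [Set.inter_comm b c]
    rw [← setIntegral_indicator hb', ← setIntegral_indicator hb',
      ← setIntegral_condExp hm' (integrable_condExp.indicator hb') hc,
      ← setIntegral_condExp hm' (hs_int.indicator hb') hc]
    exact integral_congr_ae (ae_restrict_of_ae key)
  · have hs_int : Integrable (s.indicator fun _ ↦ (1 : ℝ)) μ :=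
      (integrable_const _).indicator (hm₁ s hs)
    rw [indicator_inter_one, mul_comm]
    calc μ[t.indicator (s.indicator fun _ ↦ (1 : ℝ)) | m']
      _ =ᵐ[μ] μ[t.indicator (μ⟦s | m₂ ⊔ m'⟧) | m'] :=
        (condExp_indicator_condExp_of_le le_sup_right (sup_le hm₂ hm') hs_int
          (le_sup_left (a := m₂) t ht)).symm
      _ =ᵐ[μ] μ[t.indicator (μ⟦s | m'⟧) | m'] := condExp_congr_ae (h s hs).indicator
      _ =ᵐ[μ] (μ⟦t | m'⟧) * (μ⟦s | m'⟧) := condExp_indicator_condExp_self (hm₂ t ht)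

/-- Contraction property of conditional independence. -/
lemma CondIndep.sup_right {hm' : m' ≤ mΩ} {hm₂' : m₂ ⊔ m' ≤ mΩ}
    (hm₁ : m₁ ≤ mΩ) (hm₃ : m₃ ≤ mΩ) (h : CondIndep m' m₁ m₂ hm' μ)
    (h' : CondIndep (m₂ ⊔ m') m₁ m₃ hm₂' μ) : CondIndep m' m₁ (m₂ ⊔ m₃) hm' μ := by
  have hm₂ : m₂ ≤ mΩ := le_sup_left.trans hm₂'
  rw [condIndep_iff_condExp_sup_ae_eq hm' hm₁ hm₂] at h
  rw [condIndep_iff_condExp_sup_ae_eq hm₂' hm₁ hm₃] at h'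
  rw [condIndep_iff_condExp_sup_ae_eq hm' hm₁ (sup_le hm₂ hm₃), sup_comm m₂ m₃, sup_assoc]
  exact fun s hs ↦ (h' s hs).trans (h s hs)

/-- If `m₂` and `m₃` are conditionally independent given `m'`, then conditional independence of
`m₁` from each of them given the other one and `m'` implies that `m₁` and `m₂` are conditionally
independent given `m'`. -/
lemma CondIndep.of_sup_of_sup {hm' : m' ≤ mΩ} {hm₂' : m₂ ⊔ m' ≤ mΩ} {hm₃' : m₃ ⊔ m' ≤ mΩ}
    (hm₁ : m₁ ≤ mΩ) (h : CondIndep m' m₂ m₃ hm' μ)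
    (h₂ : CondIndep (m₃ ⊔ m') m₁ m₂ hm₃' μ) (h₃ : CondIndep (m₂ ⊔ m') m₁ m₃ hm₂' μ) :
    CondIndep m' m₁ m₂ hm' μ := by
  have hm₂ : m₂ ≤ mΩ := le_sup_left.trans hm₂'
  have hm₃ : m₃ ≤ mΩ := le_sup_left.trans hm₃'
  rw [condIndep_iff_condExp_sup_ae_eq hm' hm₂ hm₃] at h
  rw [condIndep_iff_condExp_sup_ae_eq hm₃' hm₁ hm₂] at h₂
  rw [condIndep_iff_condExp_sup_ae_eq hm₂' hm₁ hm₃] at h₃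
  rw [condIndep_iff _ _ _ hm' hm₁ hm₂]
  intro s t hs ht
  have hs_int : Integrable (s.indicator fun _ ↦ (1 : ℝ)) μ :=
    (integrable_const _).indicator (hm₁ s hs)
  have heq : μ⟦s | m₂ ⊔ m'⟧ =ᵐ[μ] μ⟦s | m₃ ⊔ m'⟧ := by
    refine (h₃ s hs).symm.trans ?_
    rw [sup_left_comm]
    exact h₂ s hs
  have hpull : μ[t.indicator (μ⟦s | m₃ ⊔ m'⟧) | m₃ ⊔ m'] =ᵐ[μ]
      (μ⟦t | m'⟧) * (μ⟦s | m₃ ⊔ m'⟧) :=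
    (condExp_indicator_condExp_self (hm₂ t ht)).trans ((h t ht).mul .rfl)
  rw [indicator_inter_one, mul_comm]
  calc μ[t.indicator (s.indicator fun _ ↦ (1 : ℝ)) | m']
    _ =ᵐ[μ] μ[t.indicator (μ⟦s | m₂ ⊔ m'⟧) | m'] :=
      (condExp_indicator_condExp_of_le le_sup_right hm₂' hs_int
        (le_sup_left (a := m₂) t ht)).symm
    _ =ᵐ[μ] μ[t.indicator (μ⟦s | m₃ ⊔ m'⟧) | m'] := condExp_congr_ae heq.indicator
    _ =ᵐ[μ] μ[μ[t.indicator (μ⟦s | m₃ ⊔ m'⟧) | m₃ ⊔ m'] | m'] :=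
      (condExp_condExp_of_le le_sup_right hm₃').symm
    _ =ᵐ[μ] μ[(μ⟦t | m'⟧) * (μ⟦s | m₃ ⊔ m'⟧) | m'] := condExp_congr_ae hpull
    _ =ᵐ[μ] (μ⟦t | m'⟧) * μ[μ⟦s | m₃ ⊔ m'⟧ | m'] :=
      condExp_mul_of_stronglyMeasurable_left stronglyMeasurable_condExp
        (integrable_condExp.congr hpull) integrable_condExp
    _ =ᵐ[μ] (μ⟦t | m'⟧) * (μ⟦s | m'⟧) :=
      Filter.EventuallyEq.rfl.mul (condExp_condExp_of_le le_sup_right hm₃')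

end ProbabilityTheory

/-- **generalised Appendix Lemma A.2.** If `G2 ⫫ G1 | W`, `U ⫫ G1 | (G2, W)`,
`U ⫫ G2 | (G1, W)` and `U ⫫ S | (G1, G2, W)`, then `U ⫫ (G1, G2, S) | W`. -/
theorem appendix_lemma_A2
    {Ω : Type*} [MeasurableSpace Ω] [StandardBorelSpace Ω] [Nonempty Ω]
    (P : MeasureTheory.Measure Ω) [IsProbabilityMeasure P]
    {EU ES E1 E2 EW : Type*}
    [MeasurableSpace EU] [MeasurableSpace ES] [MeasurableSpace E1]
    [MeasurableSpace E2] [MeasurableSpace EW]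
    (U : Ω → EU) (S : Ω → ES) (G1 : Ω → E1) (G2 : Ω → E2) (W : Ω → EW)
    (hU : Measurable U) (hS : Measurable S) (hG1 : Measurable G1)
    (hG2 : Measurable G2) (hW : Measurable W)
    -- (i) G2 ⫫ G1 | W
    (h1 : CondIndepFun (MeasurableSpace.comap W inferInstance)
      (measurable_iff_comap_le.mp hW) G2 G1 P)
    -- (ii) U ⫫ G1 | (G2, W)
    (h2 : CondIndepFun (MeasurableSpace.comap (fun ω => (G2 ω, W ω)) inferInstance)
      (measurable_iff_comap_le.mp (hG2.prod hW)) U G1 P)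
    -- (iii) U ⫫ G2 | (G1, W)
    (h3 : CondIndepFun (MeasurableSpace.comap (fun ω => (G1 ω, W ω)) inferInstance)
      (measurable_iff_comap_le.mp (hG1.prod hW)) U G2 P)
    -- (iv) U ⫫ S | (G1, G2, W)
    (h4 : CondIndepFun (MeasurableSpace.comap (fun ω => (G1 ω, G2 ω, W ω)) inferInstance)
      (measurable_iff_comap_le.mp (hG1.prod (hG2.prod hW))) U S P) :
    -- U ⫫ (G1, G2, S) | W
    CondIndepFun (MeasurableSpace.comap W inferInstance)
      (measurable_iff_comap_le.mp hW) U (fun ω => (G1 ω, G2 ω, S ω)) P := by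
  rw [condIndepFun_iff_condIndep] at h1 h2 h3 h4 ⊢
  simp only [MeasurableSpace.comap_prodMk, Prod.instMeasurableSpace] at h2 h3 h4 ⊢
  have h12 := (CondIndep.of_sup_of_sup hU.comap_le h1.symm h2 h3).sup_right
    hU.comap_le hG2.comap_le h3
  simp only [← sup_assoc] at h4 ⊢
  exact h12.sup_right hU.comap_le hS.comap_le h4
end

section
/- (Transfer of an observational conditional independence to all regimes; the step from (p19) to (p20) in the proof of Lemma 4.) Let Y, U, V, G be random variables on a probability space (Ω, 𝒜, P), each with countable (discrete) range, and let g0 be a value of G with P(G = g0) > 0. Assume: (i) Y ⊥ G | (U, V); (ii) conditionally on the event {G = g0}, Y is independent of U given V: for all values y, u, v with P(U = u, V = v, G = g0) > 0, P(Y = y | U = u, V = v, G = g0) = P(Y = y | V = v, G = g0); (iii) support condition: for every pair of values (u, v) with P(U = u, V = v) > 0, also P(U = u, V = v, G = g0) > 0. Then Y ⊥ (G, U) | V. -/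
open MeasureTheory ProbabilityTheory

namespace MeasureTheory

/-- Almost every value of a random variable with countable range is an atom of its law. -/
lemma ae_measure_fiber_ne_zero {Ω E : Type*} {mΩ : MeasurableSpace Ω} [Countable E]
    (μ : Measure Ω) (W : Ω → E) :
    ∀ᵐ ω ∂μ, μ (W ⁻¹' {W ω}) ≠ 0 := by
  refine measure_mono_null (t := ⋃ w ∈ {w | μ (W ⁻¹' {w}) = 0}, W ⁻¹' {w}) ?_ ?_
  · intro ω hω
    simpa using hω
  · exact (measure_biUnion_null_iff (Set.to_countable _)).2 fun w hw => hw

/-- The conditional expectation of an indicator given a random variable with countable range is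
the elementary conditional probability on each atom. -/
lemma condExp_indicator_comap_ae_eq {Ω E : Type*} {mΩ : MeasurableSpace Ω}
    [mE : MeasurableSpace E] [Countable E] [MeasurableSingletonClass E] {μ : Measure Ω}
    [IsFiniteMeasure μ] {W : Ω → E} (hW : Measurable W) {A : Set Ω} (hA : MeasurableSet A) :
    μ[A.indicator fun _ => (1 : ℝ) | mE.comap W] =ᵐ[μ]
      fun ω => μ.real (A ∩ W ⁻¹' {W ω}) / μ.real (W ⁻¹' {W ω}) := by
  obtain ⟨g, -, hg⟩ := (stronglyMeasurable_condExp (μ := μ) (m := mE.comap W)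
    (f := A.indicator fun _ => (1 : ℝ))).measurable.exists_eq_measurable_comp
  filter_upwards [ae_measure_fiber_ne_zero μ W] with ω hω
  have hint := setIntegral_condExp hW.comap_le
    ((integrable_const (1 : ℝ)).indicator hA : Integrable (A.indicator fun _ => (1 : ℝ)) μ)
    (s := W ⁻¹' {W ω}) ⟨_, measurableSet_singleton _, rfl⟩
  have hconst : ∫ x in W ⁻¹' {W ω}, (μ[A.indicator fun _ => (1 : ℝ) | mE.comap W]) x ∂μ =
      ∫ _ in W ⁻¹' {W ω}, g (W ω) ∂μ := by
    refine setIntegral_congr_fun (hW (measurableSet_singleton _)) fun x hx => ?_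
    rw [hg, Function.comp_apply, show W x = W ω from hx]
  rw [hconst, setIntegral_const, integral_indicator_const _ hA,
    measureReal_restrict_apply hA] at hint
  rw [hg, Function.comp_apply, eq_div_iff (by simpa [measureReal_eq_zero_iff] using hω)]
  simpa [mul_comm] using hint

end MeasureTheory

namespace ProbabilityTheory

/-- Conditional independence given a random variable with countable range, in terms of the
probabilities of the atoms. -/
lemma condIndepFun_comap_iff_measure_inter_mul {Ω E α β : Type*} [MeasurableSpace Ω]
    [StandardBorelSpace Ω] {μ : Measure Ω} [IsFiniteMeasure μ] [mE : MeasurableSpace E]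
    [Countable E] [MeasurableSingletonClass E] [MeasurableSpace α] [MeasurableSpace β]
    {X : Ω → α} {Z : Ω → β} {W : Ω → E} (hX : Measurable X) (hZ : Measurable Z)
    (hW : Measurable W) :
    CondIndepFun (mE.comap W) hW.comap_le X Z μ ↔
      ∀ s t, MeasurableSet s → MeasurableSet t → ∀ w,
        μ (X ⁻¹' s ∩ Z ⁻¹' t ∩ W ⁻¹' {w}) * μ (W ⁻¹' {w}) =
          μ (X ⁻¹' s ∩ W ⁻¹' {w}) * μ (Z ⁻¹' t ∩ W ⁻¹' {w}) := by
  rw [condIndepFun_iff_condExp_inter_preimage_eq_mul hX hZ]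
  refine forall₄_congr fun s t hs ht => ?_
  have hXZ := condExp_indicator_comap_ae_eq (μ := μ) hW ((hX hs).inter (hZ ht))
  have hXs := condExp_indicator_comap_ae_eq (μ := μ) hW (hX hs)
  have hZt := condExp_indicator_comap_ae_eq (μ := μ) hW (hZ ht)
  have key : ∀ w, μ (W ⁻¹' {w}) ≠ 0 →
      (μ.real (X ⁻¹' s ∩ Z ⁻¹' t ∩ W ⁻¹' {w}) / μ.real (W ⁻¹' {w}) =
        μ.real (X ⁻¹' s ∩ W ⁻¹' {w}) / μ.real (W ⁻¹' {w}) *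
          (μ.real (Z ⁻¹' t ∩ W ⁻¹' {w}) / μ.real (W ⁻¹' {w})) ↔
      μ (X ⁻¹' s ∩ Z ⁻¹' t ∩ W ⁻¹' {w}) * μ (W ⁻¹' {w}) =
          μ (X ⁻¹' s ∩ W ⁻¹' {w}) * μ (Z ⁻¹' t ∩ W ⁻¹' {w})) := by
    intro w hw
    have hw' : μ.real (W ⁻¹' {w}) ≠ 0 := by simpa [measureReal_eq_zero_iff] using hw
    rw [← ENNReal.toReal_eq_toReal_iff' (by finiteness) (by finiteness), ENNReal.toReal_mul,
      ENNReal.toReal_mul]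
    change _ ↔ μ.real _ * μ.real _ = μ.real _ * μ.real _
    rw [div_mul_div_comm, div_eq_div_iff hw' (mul_ne_zero hw' hw'), ← mul_assoc,
      mul_left_inj' hw']
  constructor
  · intro h w
    by_cases hw : μ (W ⁻¹' {w}) = 0
    · rw [hw, measure_inter_null_of_null_right (Z ⁻¹' t) hw, mul_zero, mul_zero]
    · obtain ⟨ω, hωw, hω⟩ := Measure.exists_mem_of_measure_ne_zero_of_ae hw
        (ae_restrict_of_ae (hXZ.symm.trans (h.trans (hXs.mul hZt))))
      obtain rfl : W ω = w := hωw
      exact (key _ hw).1 hω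
  · intro h
    refine hXZ.trans (Filter.EventuallyEq.trans ?_ (hXs.mul hZt).symm)
    filter_upwards [ae_measure_fiber_ne_zero μ W] with ω hω
    exact (key _ hω).2 (h _)

end ProbabilityTheory

/-- Transfer of an observational conditional independence to all regimes
(the step from (p19) to (p20) in the proof of Lemma 4).  For discrete random variables
`Y, U, V, G`: if `Y ⫫ G | (U, V)`, conditionally on `{G = g0}` `Y` is independent of `U`
given `V`, and the support condition holds, then `Y ⫫ (G, U) | V`. -/
theorem condIndep_transfer_observational
    {Ω : Type*} [MeasurableSpace Ω] [StandardBorelSpace Ω] [Nonempty Ω]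
    (P : MeasureTheory.Measure Ω) [IsProbabilityMeasure P]
    {EY EU EV EG : Type*}
    [MeasurableSpace EY] [Countable EY] [MeasurableSingletonClass EY]
    [MeasurableSpace EU] [Countable EU] [MeasurableSingletonClass EU]
    [MeasurableSpace EV] [Countable EV] [MeasurableSingletonClass EV]
    [MeasurableSpace EG] [Countable EG] [MeasurableSingletonClass EG]
    (Y : Ω → EY) (U : Ω → EU) (V : Ω → EV) (G : Ω → EG)
    (hY : Measurable Y) (hU : Measurable U) (hV : Measurable V) (hG : Measurable G)
    (g0 : EG) (hg0 : 0 < P {ω | G ω = g0})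
    -- (i) Y ⫫ G | (U, V)
    (h1 : CondIndepFun (MeasurableSpace.comap (fun ω => (U ω, V ω)) inferInstance)
      (measurable_iff_comap_le.mp (hU.prod hV)) Y G P)
    -- (ii) conditionally on {G = g0}, Y ⫫ U | V
    (h2 : ∀ (y : EY) (u : EU) (v : EV),
      0 < P {ω | U ω = u ∧ V ω = v ∧ G ω = g0} →
      P[|{ω | U ω = u ∧ V ω = v ∧ G ω = g0}] {ω | Y ω = y} =
        P[|{ω | V ω = v ∧ G ω = g0}] {ω | Y ω = y})
    -- (iii) support condition
    (h3 : ∀ (u : EU) (v : EV), 0 < P {ω | U ω = u ∧ V ω = v} →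
      0 < P {ω | U ω = u ∧ V ω = v ∧ G ω = g0}) :
    -- Y ⫫ (G, U) | V
    CondIndepFun (MeasurableSpace.comap V inferInstance)
      (measurable_iff_comap_le.mp hV) Y (fun ω => (G ω, U ω)) P := by
  rw [condIndepFun_comap_iff_measure_inter_mul hY hG (hU.prodMk hV)] at h1
  refine (condIndepFun_comap_iff_measure_inter_mul hY (hG.prodMk hU) hV).2 fun s t hs ht v => ?_
  set c := P[|{ω | V ω = v ∧ G ω = g0}] (Y ⁻¹' s) with hc
  have hevent : ∀ u, G ⁻¹' {g0} ∩ (fun ω => (U ω, V ω)) ⁻¹' {(u, v)} =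
      {ω | U ω = u ∧ V ω = v ∧ G ω = g0} := by
    intro u
    ext ω
    simp only [Set.mem_inter_iff, Set.mem_preimage, Set.mem_singleton_iff, Prod.mk.injEq,
      Set.mem_ofPred_eq]
    tauto
  have hcond : ∀ u, 0 < P {ω | U ω = u ∧ V ω = v ∧ G ω = g0} →
      P (Y ⁻¹' s ∩ G ⁻¹' {g0} ∩ (fun ω => (U ω, V ω)) ⁻¹' {(u, v)}) =
        c * P (G ⁻¹' {g0} ∩ (fun ω => (U ω, V ω)) ⁻¹' {(u, v)}) := by
    intro u hu
    have hmap : (P[|{ω | U ω = u ∧ V ω = v ∧ G ω = g0}]).map Y =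
        (P[|{ω | V ω = v ∧ G ω = g0}]).map Y := by
      refine Measure.ext_of_singleton fun y => ?_
      rw [Measure.map_apply hY (measurableSet_singleton y),
        Measure.map_apply hY (measurableSet_singleton y)]
      exact h2 y u v hu
    have hcs : P[|{ω | U ω = u ∧ V ω = v ∧ G ω = g0}] (Y ⁻¹' s) = c := by
      rw [hc, ← Measure.map_apply hY hs, hmap, Measure.map_apply hY hs]
    have hmeas : MeasurableSet {ω | U ω = u ∧ V ω = v ∧ G ω = g0} := by
      rw [← hevent]
      exact (hG (measurableSet_singleton _)).inter
        ((hU.prodMk hV) (measurableSet_singleton _))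
    rw [Set.inter_assoc, hevent, ← hcs, cond_mul_eq_inter hmeas, Set.inter_comm]
  have hatom : ∀ g u, P (Y ⁻¹' s ∩ G ⁻¹' {g} ∩ (fun ω => (U ω, V ω)) ⁻¹' {(u, v)}) =
      c * P (G ⁻¹' {g} ∩ (fun ω => (U ω, V ω)) ⁻¹' {(u, v)}) := by
    intro g u
    by_cases huv : P ((fun ω => (U ω, V ω)) ⁻¹' {(u, v)}) = 0
    · rw [measure_inter_null_of_null_right _ huv, measure_inter_null_of_null_right _ huv,
        mul_zero]
    have hset : (fun ω => (U ω, V ω)) ⁻¹' {(u, v)} = {ω | U ω = u ∧ V ω = v} := by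
      ext ω; simp
    have hpos := h3 u v (by rw [← hset]; exact pos_iff_ne_zero.2 huv)
    have hg := h1 s {g} hs (measurableSet_singleton _) (u, v)
    have hgg := h1 s {g0} hs (measurableSet_singleton _) (u, v)
    rw [hcond u hpos, mul_right_comm] at hgg
    rw [← hevent] at hpos
    rw [← (ENNReal.mul_left_inj hpos.ne' (measure_ne_top _ _)).1 hgg, mul_right_comm] at hg
    exact (ENNReal.mul_left_inj huv (measure_ne_top _ _)).1 hg
  have hlaw : (P.restrict (Y ⁻¹' s ∩ V ⁻¹' {v})).map (fun ω => (G ω, U ω)) =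
      c • (P.restrict (V ⁻¹' {v})).map (fun ω => (G ω, U ω)) := by
    refine Measure.ext_of_singleton fun ⟨g, u⟩ => ?_
    have hm := (hG.prodMk hU) (measurableSet_singleton (g, u))
    rw [Measure.smul_apply, Measure.map_apply (hG.prodMk hU) (measurableSet_singleton _),
      Measure.map_apply (hG.prodMk hU) (measurableSet_singleton _), Measure.restrict_apply hm,
      Measure.restrict_apply hm, smul_eq_mul]
    convert hatom g u using 2
    · ext ω; simp; tauto
    · congr 1; ext ω; simp; tauto
  have hT : ∀ r, MeasurableSet r → P (Y ⁻¹' s ∩ (fun ω => (G ω, U ω)) ⁻¹' r ∩ V ⁻¹' {v}) =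
      c * P ((fun ω => (G ω, U ω)) ⁻¹' r ∩ V ⁻¹' {v}) := by
    intro r hr
    have h := congrArg (fun ν => ν r) hlaw
    simp only [Measure.smul_apply, Measure.map_apply (hG.prodMk hU) hr,
      Measure.restrict_apply ((hG.prodMk hU) hr), smul_eq_mul] at h
    rw [← h, Set.inter_comm (Y ⁻¹' s), Set.inter_assoc]
  have huniv := hT Set.univ MeasurableSet.univ
  rw [Set.preimage_univ, Set.inter_univ, Set.univ_inter] at huniv
  rw [hT t ht, huniv]
  ring
end

section
/- (Derivation of (pp3) in the proof of Lemma 4, in regime-indexed form.) In the two-intervention regime-indexed model, let X0*, H, Z, X1* be random variables on Ω, with X0 = X0* holding μ_r-almost surely in every regime r = (f0, f1) with f0 = e, and X0 = f0 μ_r-almost surely when f0 ≠ e. Assume: (a) [(H, Z, X1*) ⊥ (F0, X0*) | (F1, X0)] there exist probability kernels κ(· | f1, x0) such that for every regime r = (f0, f1), every x0 and x0* with μ_r(X0 = x0, X0* = x0*) > 0, and every measurable set A, μ_r((H, Z, X1*) ∈ A | X0 = x0, X0* = x0*) = κ(A | f1, x0); (b) [(X0*, X0, H, Z, X1*) ⊥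 F1 | F0] for any two regimes r = (f0, f1) and r' = (f0, f1') with the same first component, the joint distribution of (X0*, X0, H, Z, X1*) is the same under μ_r and μ_{r'}. Then (H, Z, X1*) ⊥ (F0, F1) | X0: there exist probability kernels ρ(· | x0) such that for every regime r with μ_r(X0 = x0) > 0 and every measurable set A, μ_r((H, Z, X1*) ∈ A | X0 = x0) = ρ(A | x0). -/
open MeasureTheory ProbabilityTheory

/-- Law of total probability over a countable discrete random variable `Y`. -/
lemma measure_eq_tsum_inter_fiber {Ω 𝒴 : Type*} [MeasurableSpace Ω] [Countable 𝒴]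
    [MeasurableSpace 𝒴] [MeasurableSingletonClass 𝒴] (μ : Measure Ω) {Y : Ω → 𝒴}
    (hY : Measurable Y) (S : Set Ω) :
    μ S = ∑' y, μ ({ω | Y ω = y} ∩ S) := by
  have hfib (y : 𝒴) : MeasurableSet {ω | Y ω = y} := hY (measurableSet_singleton y)
  have hunion : ⋃ y, {ω | Y ω = y} = Set.univ := by ext; simp
  have hdisj : Pairwise (Function.onFun Disjoint fun y => {ω | Y ω = y}) := by
    intro a b hab
    exact Set.disjoint_left.mpr fun ω ha hb => hab (ha.symm.trans hb)
  rw [← Measure.restrict_apply_univ S, ← hunion, measure_iUnion hdisj hfib]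
  exact tsum_congr fun y => Measure.restrict_apply (hfib y)

/-- If the conditional probability of `T` given `B` and `Y = y` is the same constant `c` for
every `y` of positive probability, then it is also the conditional probability given `B`. -/
lemma cond_eq_of_forall_cond_inter_fiber_eq {Ω 𝒴 : Type*} [MeasurableSpace Ω] [Countable 𝒴]
    [MeasurableSpace 𝒴] [MeasurableSingletonClass 𝒴] (μ : Measure Ω) [IsFiniteMeasure μ]
    {Y : Ω → 𝒴} (hY : Measurable Y) {B T : Set Ω} (hB : MeasurableSet B) (hBpos : 0 < μ B)
    (c : ENNReal) (h : ∀ y, 0 < μ (B ∩ {ω | Y ω = y}) → μ[|B ∩ {ω | Y ω = y}] T = c) :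
    μ[|B] T = c := by
  have key : μ (B ∩ T) = c * μ B := by
    rw [measure_eq_tsum_inter_fiber μ hY (B ∩ T), measure_eq_tsum_inter_fiber μ hY B,
      ← ENNReal.tsum_mul_left]
    refine tsum_congr fun y => ?_
    have hBy : MeasurableSet (B ∩ {ω | Y ω = y}) := hB.inter (hY (measurableSet_singleton y))
    rw [← Set.inter_assoc, Set.inter_comm _ B]
    rcases eq_or_ne (μ (B ∩ {ω | Y ω = y})) 0 with h0 | h0
    · rw [h0, mul_zero]
      exact measure_mono_null Set.inter_subset_left h0
    · rw [← h y (pos_iff_ne_zero.mpr h0), cond_mul_eq_inter hBy]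
  rw [cond_apply hB, key, mul_comm c, ← mul_assoc,
    ENNReal.inv_mul_cancel hBpos.ne' (measure_ne_top μ B), one_mul]

/-- **derivation of (pp3) in the proof of Lemma 4, regime-indexed form.**
In the two-intervention regime-indexed model, if
(a) `(H, Z, X1*) ⫫ (F0, X0*) | (F1, X0)` — the conditional distribution of `(H, Z, X1*)`
given `(X0 = x0, X0* = x0*)` depends only on `(f1, x0)` — and
(b) `(X0*, X0, H, Z, X1*) ⫫ F1 | F0` — its joint distribution with `X0*, X0` is unchanged
when only the second regime component varies — then `(H, Z, X1*) ⫫ (F0, F1) | X0`: there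
are probability kernels `ρ(· | x0)` giving the conditional distribution of `(H, Z, X1*)`
given `X0 = x0` in every regime. -/
theorem dt_pp3_derivation
    {Ω : Type*} [MeasurableSpace Ω]
    {𝒳0 𝒳1 : Type*} [Countable 𝒳0] [Countable 𝒳1]
    [MeasurableSpace 𝒳0] [MeasurableSingletonClass 𝒳0]
    [MeasurableSpace 𝒳1] [MeasurableSingletonClass 𝒳1]
    {𝓗 𝓩 : Type*} [MeasurableSpace 𝓗] [MeasurableSpace 𝓩]
    (μ : Option 𝒳0 × Option 𝒳1 → Measure Ω)
    [∀ r, IsProbabilityMeasure (μ r)]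
    (X0 X0star : Ω → 𝒳0) (H : Ω → 𝓗) (Z : Ω → 𝓩) (X1star : Ω → 𝒳1)
    (hX0 : Measurable X0) (hX0star : Measurable X0star)
    (hH : Measurable H) (hZ : Measurable Z) (hX1star : Measurable X1star)
    (hIdle : ∀ f1 : Option 𝒳1, ∀ᵐ ω ∂(μ (none, f1)), X0 ω = X0star ω)
    (hInterv : ∀ (x0 : 𝒳0) (f1 : Option 𝒳1), ∀ᵐ ω ∂(μ (some x0, f1)), X0 ω = x0)
    -- (a) (H, Z, X1*) ⫫ (F0, X0*) | (F1, X0)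
    (κ : Option 𝒳1 → 𝒳0 → Measure (𝓗 × 𝓩 × 𝒳1))
    (hκprob : ∀ f1 x0, IsProbabilityMeasure (κ f1 x0))
    (hκ : ∀ (f0 : Option 𝒳0) (f1 : Option 𝒳1) (x0 x0star : 𝒳0),
      0 < μ (f0, f1) {ω | X0 ω = x0 ∧ X0star ω = x0star} →
      ∀ A : Set (𝓗 × 𝓩 × 𝒳1), MeasurableSet A →
        (μ (f0, f1))[|{ω | X0 ω = x0 ∧ X0star ω = x0star}]
            {ω | (H ω, Z ω, X1star ω) ∈ A} = κ f1 x0 A)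
    -- (b) (X0*, X0, H, Z, X1*) ⫫ F1 | F0
    (hb : ∀ (f0 : Option 𝒳0) (f1 f1' : Option 𝒳1),
      (μ (f0, f1)).map (fun ω => (X0star ω, X0 ω, H ω, Z ω, X1star ω)) =
        (μ (f0, f1')).map (fun ω => (X0star ω, X0 ω, H ω, Z ω, X1star ω))) :
    -- conclusion: (H, Z, X1*) ⫫ (F0, F1) | X0
    ∃ ρ : 𝒳0 → Measure (𝓗 × 𝓩 × 𝒳1),
      (∀ x0, IsProbabilityMeasure (ρ x0)) ∧
      ∀ (r : Option 𝒳0 × Option 𝒳1) (x0 : 𝒳0),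
        0 < μ r {ω | X0 ω = x0} →
        ∀ A : Set (𝓗 × 𝓩 × 𝒳1), MeasurableSet A →
          (μ r)[|{ω | X0 ω = x0}] {ω | (H ω, Z ω, X1star ω) ∈ A} = ρ x0 A := by
  refine ⟨κ none, hκprob none, ?_⟩
  rintro ⟨f0, f1⟩ x0 hpos A hA
  have hV : Measurable fun ω => (H ω, Z ω, X1star ω) := hH.prodMk (hZ.prodMk hX1star)
  have hlaw : Measurable fun ω => (X0star ω, X0 ω, H ω, Z ω, X1star ω) :=
    hX0star.prodMk (hX0.prodMk hV)
  have hB : MeasurableSet {ω | X0 ω = x0} := hX0 (measurableSet_singleton x0)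
  have htransfer {C : Set (𝓗 × 𝓩 × 𝒳1)} (hC : MeasurableSet C) :
      μ (f0, f1) ({ω | X0 ω = x0} ∩ {ω | (H ω, Z ω, X1star ω) ∈ C}) =
        μ (f0, none) ({ω | X0 ω = x0} ∩ {ω | (H ω, Z ω, X1star ω) ∈ C}) := by
    have hS : MeasurableSet ((Set.univ : Set 𝒳0) ×ˢ ({x0} : Set 𝒳0) ×ˢ C) :=
      MeasurableSet.univ.prod ((measurableSet_singleton x0).prod hC)
    have hpre : (fun ω => (X0star ω, X0 ω, H ω, Z ω, X1star ω)) ⁻¹'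
        ((Set.univ : Set 𝒳0) ×ˢ ({x0} : Set 𝒳0) ×ˢ C) =
        {ω | X0 ω = x0} ∩ {ω | (H ω, Z ω, X1star ω) ∈ C} := by
      ext ω
      simp
    rw [← hpre, ← Measure.map_apply hlaw hS, ← Measure.map_apply hlaw hS, hb f0 f1 none]
  have hmarg : μ (f0, f1) {ω | X0 ω = x0} = μ (f0, none) {ω | X0 ω = x0} := by
    simpa using htransfer MeasurableSet.univ
  rw [cond_apply hB, hmarg, htransfer hA, ← cond_apply hB]
  exact cond_eq_of_forall_cond_inter_fiber_eq (μ (f0, none)) hX0star hB (hmarg ▸ hpos) _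
    fun y hy => hκ f0 none x0 y hy A hA
end
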